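/- Let G, H be primitive graphs and P : E_G × E_H → ℤ a payoff function. There exist n_1, k ∈ ℕ with k ≥ 1 and V† ∈ ℤ such that for all v, w ∈ V_H and all n ≥ n_1: (i) M†_{n+k}(v→w) = {f + V† : f ∈ M†_n(v→w)} (pointwise addition of the constant V†), and (ii) V_{n+k}(G,H,P) = V_n(G,H,P) + V†. Furthermore, for any k ≥ 1, n_1 ∈ ℕ and V† ∈ ℤ satisfying property (i), the limit lim_{n→∞} (1/n)·V_n(G,H,P) exists and equals V†/k. -/

import Mathlib

open Filter Set

structure DirGraph (V E : Type) where
  src : E → V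
  tgt : E → V

namespace DirGraph

variable {V E : Type}

/-- A (finite) walk: consecutive edges are compatible. -/
def IsWalkList (G : DirGraph V E) (p : List E) : Prop :=
  p.Chain' fun e f => G.tgt e = G.src f

/-- The set of walks of length `n`. -/
def walks (G : DirGraph V E) (n : ℕ) : Set (List E) :=
  {p | p.length = n ∧ G.IsWalkList p}

/-- The set of walks of length `n` from `v` to `w`. -/
def walksFT (G : DirGraph V E) (n : ℕ) (v w : V) : Set (List E) :=
  {p | p.length = n ∧ G.IsWalkList p ∧
    ∃ h : p ≠ [], G.src (p.head h) = v ∧ G.tgt (p.getLast h) = w}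

def IsCycle (G : DirGraph V E) (p : List E) : Prop :=
  G.IsWalkList p ∧ ∃ h : p ≠ [], G.src (p.head h) = G.tgt (p.getLast h)

def Irreducible (G : DirGraph V E) : Prop :=
  ∀ v w : V, ∃ n : ℕ, (G.walksFT n v w).Nonempty

/-- Irreducible and the gcd of all cycle lengths is 1 (every common divisor of
the cycle lengths equals 1). -/
def Primitive (G : DirGraph V E) : Prop :=
  G.Irreducible ∧ ∀ d : ℕ, (∀ p, G.IsCycle p → d ∣ p.length) → d = 1

end DirGraph

/-- `Σ_i P(q_i, p_i)`. -/
def payoffSum {EG EH : Type} (P : EG → EH → ℤ) (q : List EG) (p : List EH) : ℤ :=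
  (List.zipWith P q p).sum

/-- `V_n(G,H,P) = max_{p ∈ W_n(H)} min_{q ∈ W_n(G)} Σ P(q_i,p_i)`. -/
noncomputable def Vn {VG EG VH EH : Type} (G : DirGraph VG EG) (H : DirGraph VH EH)
    (P : EG → EH → ℤ) (n : ℕ) : ℤ :=
  sSup ((fun p => sInf ((fun q => payoffSum P q p) '' G.walks n)) '' H.walks n)

/-- `M(p)(v,w) = inf {Σ P(q_i,p_i) : q ∈ W_n(G, v → w)}`, with `inf ∅ = ⊤`. -/
noncomputable def Mfun {VG EG EH : Type} (G : DirGraph VG EG) (P : EG → EH → ℤ)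
    (p : List EH) : VG → VG → WithTop ℤ :=
  fun v w => sInf ((fun q => ((payoffSum P q p : ℤ) : WithTop ℤ)) '' G.walksFT p.length v w)

/-- `f < g` pointwise everywhere. -/
def StrictDom {V α : Type} [LT α] (f g : V → V → α) : Prop := ∀ v w, f v w < g v w

/-- `<`-maximal elements of a set w.r.t. a strict domination relation. -/
def maxElems {α : Type} (lt : α → α → Prop) (A : Set α) : Set α :=
  {f ∈ A | ¬ ∃ g ∈ A, lt f g}

/-- Tropical convolution on `(ℤ ∪ {∞})`-valued matrices. -/
noncomputable def tconv {V : Type} (f g : V → V → WithTop ℤ) : V → V → WithTop ℤ :=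
  fun u w => sInf (Set.range fun v => f u v + g v w)

/-- Tropical convolution on `ℤ`-valued matrices. -/
noncomputable def tconvZ {V : Type} (f g : V → V → ℤ) : V → V → ℤ :=
  fun u w => sInf (Set.range fun v => f u v + g v w)

/-- Non-improvable walks in `H` (of any length). -/
noncomputable def walksDagger {VG EG VH EH : Type} (G : DirGraph VG EG) (H : DirGraph VH EH)
    (P : EG → EH → ℤ) : Set (List EH) :=
  {p | ∃ u v : VH, p ∈ H.walksFT p.length u v ∧
    Mfun G P p ∈ maxElems StrictDom (Mfun G P '' H.walksFT p.length u v)}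

/-- The edge shift of a graph. -/
def XEdge {V E : Type} (G : DirGraph V E) : Set (ℤ → E) :=
  {x | ∀ n : ℤ, G.tgt (x n) = G.src (x (n + 1))}

/-- The word `x_{[m,n]}` as a list (of length `n - m + 1` when `m ≤ n`). -/
def seg {A : Type} (x : ℤ → A) (m n : ℤ) : List A :=
  List.ofFn fun i : Fin (n + 1 - m).toNat => x (m + i)

/-- `X_H^†`: points all of whose subwords are non-improvable walks. -/
noncomputable def XHdag {VG EG VH EH : Type} (G : DirGraph VG EG) (H : DirGraph VH EH)
    (P : EG → EH → ℤ) : Set (ℤ → EH) :=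
  {x | x ∈ XEdge H ∧ ∀ m n : ℤ, m ≤ n → seg x m n ∈ walksDagger G H P}

/-- `R(p)`: optimal responses to `p`. -/
noncomputable def Rset {VG EG EH : Type} (G : DirGraph VG EG) (P : EG → EH → ℤ)
    (p : List EH) : Set (List EG) :=
  {q | ∃ v w : VG, q ∈ G.walksFT p.length v w ∧
    ((payoffSum P q p : ℤ) : WithTop ℤ) = Mfun G P p v w}

/-- Pointwise addition of an integer constant to a `(ℤ ∪ {∞})`-valued matrix. -/
noncomputable def addConst {V : Type} (c : ℤ) (f : V → V → WithTop ℤ) :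
    V → V → WithTop ℤ :=
  fun a b => f a b + (c : WithTop ℤ)

namespace DirGraph

variable {V E : Type} {G : DirGraph V E}

theorem append_mem_walksFT {m n : ℕ} {u v w : V} {p q : List E}
    (hp : p ∈ G.walksFT m u v) (hq : q ∈ G.walksFT n v w) : p ++ q ∈ G.walksFT (m + n) u w := by
  obtain ⟨hpl, hpw, hp0, hps, hpt⟩ := hp
  obtain ⟨hql, hqw, hq0, hqs, hqt⟩ := hq
  refine ⟨by simp [hpl, hql], List.isChain_append.2 ⟨hpw, hqw, fun x hx y hy => ?_⟩,
    by simp [hp0], ?_, ?_⟩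
  · rw [List.getLast?_eq_some_getLast hp0, Option.mem_some_iff] at hx
    rw [List.head?_eq_some_head hq0, Option.mem_some_iff] at hy
    rw [← hx, ← hy, hpt, hqs]
  · rw [List.head_append_of_ne_nil hp0, hps]
  · rw [List.getLast_append_of_ne_nil _ hq0, hqt]

theorem exists_mem_walksFT_of_append {n : ℕ} {u w : V} {p q : List E} (hp : p ≠ [])
    (hq : q ≠ []) (h : p ++ q ∈ G.walksFT n u w) :
    ∃ v, p ∈ G.walksFT p.length u v ∧ q ∈ G.walksFT q.length v w := by
  obtain ⟨-, hw, h0, hs, ht⟩ := h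
  obtain ⟨hpw, hqw, hpq⟩ := List.isChain_append.1 hw
  rw [List.head_append_of_ne_nil hp] at hs
  rw [List.getLast_append_of_ne_nil _ hq] at ht
  refine ⟨G.src (q.head hq), ⟨rfl, hpw, hp, hs, ?_⟩, ⟨rfl, hqw, hq, rfl, ht⟩⟩
  exact hpq _ (List.getLast?_eq_some_getLast hp) _ (List.head?_eq_some_head hq)

theorem walksFT_subset_walks {n : ℕ} {u w : V} : G.walksFT n u w ⊆ G.walks n :=
  fun _ h => ⟨h.1, h.2.1⟩

theorem exists_mem_walksFT_of_mem_walks {n : ℕ} (hn : n ≠ 0) {p : List E} (h : p ∈ G.walks n) :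
    ∃ u w, p ∈ G.walksFT n u w := by
  have hp : p ≠ [] := by
    rintro rfl
    exact hn h.1.symm
  exact ⟨_, _, h.1, h.2, hp, rfl, rfl⟩

theorem finite_walks [Finite E] (n : ℕ) : (G.walks n).Finite :=
  (List.finite_length_eq E n).subset fun _ h => h.1

theorem finite_walksFT [Finite E] (n : ℕ) (u w : V) : (G.walksFT n u w).Finite :=
  (finite_walks n).subset walksFT_subset_walks

theorem Primitive.nonempty (hG : G.Primitive) : Nonempty V := by
  by_contra h
  have h2 := hG.2 2 fun p hp => (h ⟨G.src (p.head hp.2.choose)⟩).elim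
  omega

theorem Primitive.exists_walksFT_self_nonempty (hG : G.Primitive) (v : V) :
    ∃ N, ∀ n ≥ N, (G.walksFT n v v).Nonempty := by
  set L : Set ℕ := {n | (G.walksFT n v v).Nonempty} with hL
  have hgcd : Nat.setGcd L = 1 := by
    refine hG.2 _ fun p ⟨hpw, hp0, hp⟩ => ?_
    obtain ⟨a, α, hα⟩ := hG.1 v (G.src (p.head hp0))
    obtain ⟨b, β, hβ⟩ := hG.1 (G.src (p.head hp0)) v
    have hp' : p ∈ G.walksFT p.length (G.src (p.head hp0)) (G.src (p.head hp0)) :=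
      ⟨rfl, hpw, hp0, rfl, hp.symm⟩
    have h₁ : Nat.setGcd L ∣ a + b := Nat.setGcd_dvd_of_mem ⟨_, append_mem_walksFT hα hβ⟩
    have h₂ : Nat.setGcd L ∣ a + b + p.length := by
      have h := append_mem_walksFT (append_mem_walksFT hα hp') hβ
      rw [show a + b + p.length = a + p.length + b by ring]
      exact Nat.setGcd_dvd_of_mem ⟨_, h⟩
    exact (Nat.dvd_add_right h₁).1 h₂
  obtain ⟨N, hN⟩ := Nat.exists_mem_closure_of_ge L
  refine ⟨N + 1, fun n hn => ?_⟩
  have hmem := hN n (by omega) (by simp [hgcd])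
  have key : n = 0 ∨ n ∈ L := by
    refine AddSubmonoid.closure_induction (fun x hx => Or.inr hx) (Or.inl rfl) ?_ hmem
    rintro x y - - (rfl | ⟨p, hp⟩) hy
    · simpa using hy
    · rcases hy with rfl | ⟨q, hq⟩
      · exact Or.inr ⟨p, hp⟩
      · exact Or.inr ⟨_, append_mem_walksFT hp hq⟩
  exact key.resolve_left (by omega)

theorem Primitive.exists_walksFT_nonempty [Finite V] (hG : G.Primitive) :
    ∃ N, ∀ n ≥ N, ∀ v w, (G.walksFT n v w).Nonempty := by
  have : ∀ x : V × V, ∃ N, ∀ n ≥ N, (G.walksFT n x.1 x.2).Nonempty := by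
    rintro ⟨v, w⟩
    obtain ⟨a, α, hα⟩ := hG.1 v w
    obtain ⟨N, hN⟩ := hG.exists_walksFT_self_nonempty v
    refine ⟨N + a, fun n hn => ?_⟩
    obtain ⟨p, hp⟩ := hN (n - a) (by omega)
    have h := append_mem_walksFT hp hα
    rw [show n - a + a = n by omega] at h
    exact ⟨_, h⟩
  choose N hN using this
  obtain ⟨M, hM⟩ := (Set.finite_range N).bddAbove
  exact ⟨M, fun n hn v w => hN (v, w) n ((hM ⟨(v, w), rfl⟩).trans hn)⟩

end DirGraph

section Payoff

variable {EG EH : Type} {P : EG → EH → ℤ}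

theorem payoffSum_append {q₁ q₂ : List EG} {p₁ p₂ : List EH} (h : q₁.length = p₁.length) :
    payoffSum P (q₁ ++ q₂) (p₁ ++ p₂) = payoffSum P q₁ p₁ + payoffSum P q₂ p₂ := by
  rw [payoffSum, List.zipWith_append h, List.sum_append, payoffSum, payoffSum]

theorem payoffSum_flip (q : List EG) (p : List EH) :
    payoffSum (flip P) p q = payoffSum P q p := by
  rw [payoffSum, List.zipWith_comm]
  rfl

theorem abs_payoffSum_le {B : ℤ} (hB : ∀ e h, |P e h| ≤ B) (q : List EG) (p : List EH)
    (hqp : q.length = p.length) : |payoffSum P q p| ≤ q.length * B := by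
  induction q generalizing p with
  | nil => simp [payoffSum]
  | cons e q ih =>
    cases p with
    | nil => simp at hqp
    | cons h p =>
      have h₁ := ih p (by simpa using hqp)
      have h₂ := hB e h
      have h₃ : payoffSum P (e :: q) (h :: p) = P e h + payoffSum P q p := by simp [payoffSum]
      rw [h₃]
      refine (abs_add_le _ _).trans ?_
      push_cast [List.length_cons]
      linarith

/-- In a primitive graph, any long walk can be rerouted so as to have prescribed endpoints,
changing all payoffs by at most a constant. -/
theorem DirGraph.Primitive.exists_reroute {V : Type} [Finite V] [Finite EG] [Finite EH]
    {G : DirGraph V EG} (hG : G.Primitive) (P : EG → EH → ℤ) :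
    ∃ (N : ℕ) (C : ℤ), ∀ n ≥ N, ∀ q ∈ G.walks n, ∀ v w : V, ∃ q' ∈ G.walksFT n v w,
      ∀ p : List EH, p.length = n → |payoffSum P q p - payoffSum P q' p| ≤ C := by
  obtain ⟨B, hB⟩ : ∃ B : ℤ, ∀ e h, |P e h| ≤ B := by
    obtain ⟨B, hB⟩ := (Set.finite_range fun x : EG × EH => |P x.1 x.2|).bddAbove
    exact ⟨B, fun e h => hB ⟨(e, h), rfl⟩⟩
  obtain ⟨N₀, hN₀⟩ := hG.exists_walksFT_nonempty
  set N := N₀ + 1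
  refine ⟨2 * N + 1, 4 * (N * B), fun n hn q hq v w => ?_⟩
  obtain ⟨x, y, hxy⟩ := DirGraph.exists_mem_walksFT_of_mem_walks (by omega) hq
  have hql : q.length = n := hq.1
  set a := q.take N
  set m := (q.drop N).take (n - 2 * N)
  set b := (q.drop N).drop (n - 2 * N)
  have ha : a.length = N := by simp [a]; omega
  have hm : m.length = n - 2 * N := by simp [m]; omega
  have hb : b.length = N := by simp [b]; omega
  have hqe : q = a ++ (m ++ b) := by simp only [a, m, b, List.take_append_drop]
  have ha0 : a ≠ [] := List.ne_nil_of_length_pos (by omega)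
  have hm0 : m ≠ [] := List.ne_nil_of_length_pos (by omega)
  have hb0 : b ≠ [] := List.ne_nil_of_length_pos (by omega)
  rw [hqe] at hxy
  obtain ⟨s, -, hmb⟩ := DirGraph.exists_mem_walksFT_of_append ha0 (by simp [hm0]) hxy
  obtain ⟨t, hm', -⟩ := DirGraph.exists_mem_walksFT_of_append hm0 hb0 hmb
  obtain ⟨a', ha'⟩ := hN₀ N (by omega) v s
  obtain ⟨b', hb'⟩ := hN₀ N (by omega) t w
  have hq' := DirGraph.append_mem_walksFT ha' (DirGraph.append_mem_walksFT hm' hb')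
  rw [hm, show N + (n - 2 * N + N) = n by omega] at hq'
  refine ⟨_, hq', fun p hp => ?_⟩
  set c := p.take N
  set d := (p.drop N).take (n - 2 * N)
  set e := (p.drop N).drop (n - 2 * N)
  have hc : c.length = N := by simp [c]; omega
  have hd : d.length = n - 2 * N := by simp [d]; omega
  have he : e.length = N := by simp [e]; omega
  have hpe : p = c ++ (d ++ e) := by simp only [c, d, e, List.take_append_drop]
  rw [hqe, hpe, payoffSum_append (ha.trans hc.symm), payoffSum_append (hm.trans hd.symm),
    payoffSum_append (ha'.1.trans hc.symm), payoffSum_append (hm.trans hd.symm)]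
  have h₁ := abs_le.1 (abs_payoffSum_le hB a c (ha.trans hc.symm))
  have h₂ := abs_le.1 (abs_payoffSum_le hB b e (hb.trans he.symm))
  have h₃ := abs_le.1 (abs_payoffSum_le hB a' c (ha'.1.trans hc.symm))
  have h₄ := abs_le.1 (abs_payoffSum_le hB b' e (hb'.1.trans he.symm))
  rw [ha] at h₁
  rw [hb] at h₂
  rw [ha'.1] at h₃
  rw [hb'.1] at h₄
  rw [abs_le]
  constructor <;> linarith [h₁.1, h₁.2, h₂.1, h₂.2, h₃.1, h₃.2, h₄.1, h₄.2]

end Payoff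

section MaxElems

variable {α : Type} {lt : α → α → Prop} {A B : Set α}

theorem mem_maxElems_or_exists_lt (irrefl : ∀ a, ¬ lt a a)
    (trans : ∀ a b c, lt a b → lt b c → lt a c) (hA : A.Finite) {a : α} (ha : a ∈ A) :
    a ∈ maxElems lt A ∨ ∃ b ∈ maxElems lt A, lt a b := by
  have : IsStrictOrder α (flip lt) :=
    { irrefl := irrefl, trans := fun a b c hab hbc => trans c b a hbc hab }
  refine (hA.wellFoundedOn (r := flip lt)).induction ha
    (P := fun a => a ∈ maxElems lt A ∨ ∃ b ∈ maxElems lt A, lt a b) fun y hy ih => ?_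
  by_cases h : ∃ g ∈ A, lt y g
  · obtain ⟨g, hg, hyg⟩ := h
    rcases ih g hg hyg with h | ⟨b, hb, hgb⟩
    · exact Or.inr ⟨g, h, hyg⟩
    · exact Or.inr ⟨b, hb, trans _ _ _ hyg hgb⟩
  · exact Or.inl ⟨hy, h⟩

theorem maxElems_eq_of_cofinal (trans : ∀ a b c, lt a b → lt b c → lt a c) (hBA : B ⊆ A)
    (h : ∀ a ∈ A, a ∈ B ∨ ∃ b ∈ B, lt a b) : maxElems lt A = maxElems lt B := by
  ext a
  constructor
  · rintro ⟨ha, hmax⟩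
    refine ⟨(h a ha).resolve_right fun ⟨b, hb, hab⟩ => hmax ⟨b, hBA hb, hab⟩, ?_⟩
    rintro ⟨b, hb, hab⟩
    exact hmax ⟨b, hBA hb, hab⟩
  · rintro ⟨ha, hmax⟩
    refine ⟨hBA ha, ?_⟩
    rintro ⟨b, hb, hab⟩
    rcases h b hb with hb' | ⟨c, hc, hbc⟩
    · exact hmax ⟨b, hb', hab⟩
    · exact hmax ⟨c, hc, trans _ _ _ hab hbc⟩

end MaxElems

section StrictDom

variable {V : Type}

theorem not_strictDom_self [Nonempty V] (f : V → V → WithTop ℤ) : ¬ StrictDom f f :=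
  fun h => lt_irrefl _ (h (Classical.arbitrary V) (Classical.arbitrary V))

theorem StrictDom.trans (f g h : V → V → WithTop ℤ) (hfg : StrictDom f g) (hgh : StrictDom g h) :
    StrictDom f h :=
  fun v w => (hfg v w).trans (hgh v w)

theorem strictDom_addConst_iff {c : ℤ} {f g : V → V → WithTop ℤ} :
    StrictDom (addConst c f) (addConst c g) ↔ StrictDom f g :=
  forall₂_congr fun _ _ => WithTop.add_lt_add_iff_right WithTop.coe_ne_top

theorem addConst_addConst (c d : ℤ) (f : V → V → WithTop ℤ) :
    addConst c (addConst d f) = addConst (d + c) f := by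
  funext v w
  simp only [addConst, add_assoc, WithTop.coe_add]

theorem addConst_zero (f : V → V → WithTop ℤ) : addConst 0 f = f := by
  funext v w
  simp [addConst]

theorem maxElems_addConst_image (c : ℤ) (A : Set (V → V → WithTop ℤ)) :
    maxElems StrictDom (addConst c '' A) = addConst c '' maxElems StrictDom A := by
  ext f
  constructor
  · rintro ⟨⟨g, hg, rfl⟩, hmax⟩
    exact ⟨g, ⟨hg, fun ⟨h, hh, hgh⟩ =>
      hmax ⟨_, ⟨h, hh, rfl⟩, strictDom_addConst_iff.2 hgh⟩⟩, rfl⟩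
  · rintro ⟨g, ⟨hg, hmax⟩, rfl⟩
    refine ⟨⟨g, hg, rfl⟩, ?_⟩
    rintro ⟨_, ⟨h, hh, rfl⟩, hgh⟩
    exact hmax ⟨h, hh, strictDom_addConst_iff.1 hgh⟩

end StrictDom

section TropicalConvolution

variable {V : Type} [Finite V] {f g : V → V → WithTop ℤ}

theorem tconv_le (f g : V → V → WithTop ℤ) (u v w : V) : tconv f g u w ≤ f u v + g v w := by
  have : Nonempty V := ⟨v⟩
  obtain ⟨x, hx⟩ := Finite.exists_min fun v => f u v + g v w
  have h : IsLeast (Set.range fun v => f u v + g v w) (f u x + g x w) :=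
    ⟨⟨x, rfl⟩, by rintro _ ⟨y, rfl⟩; exact hx y⟩
  rw [tconv, h.csInf_eq]
  exact hx v

theorem exists_tconv_eq [Nonempty V] (f g : V → V → WithTop ℤ) (u w : V) :
    ∃ v, tconv f g u w = f u v + g v w := by
  obtain ⟨x, hx⟩ := Finite.exists_min fun v => f u v + g v w
  have h : IsLeast (Set.range fun v => f u v + g v w) (f u x + g x w) :=
    ⟨⟨x, rfl⟩, by rintro _ ⟨y, rfl⟩; exact hx y⟩
  exact ⟨x, h.csInf_eq⟩

theorem tconv_addConst [Nonempty V] (c : ℤ) (f g : V → V → WithTop ℤ) :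
    tconv (addConst c f) g = addConst c (tconv f g) := by
  funext u w
  apply le_antisymm
  · obtain ⟨v, hv⟩ := exists_tconv_eq f g u w
    refine (tconv_le _ _ u v w).trans_eq ?_
    rw [addConst, addConst, hv, add_right_comm]
  · obtain ⟨v, hv⟩ := exists_tconv_eq (addConst c f) g u w
    rw [hv, addConst, addConst, add_right_comm]
    gcongr
    exact tconv_le f g u v w

theorem StrictDom.tconv_right [Nonempty V] {f' : V → V → WithTop ℤ} (h : StrictDom f f')
    (hg : ∀ w, ∃ v, g v w ≠ ⊤) : StrictDom (tconv f g) (tconv f' g) := by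
  intro u w
  obtain ⟨v, hv⟩ := exists_tconv_eq f' g u w
  rw [hv]
  by_cases htop : g v w = ⊤
  · obtain ⟨v₀, hv₀⟩ := hg w
    rw [htop, add_top]
    exact (tconv_le f g u v₀ w).trans_lt
      (WithTop.add_lt_top.2 ⟨(h u v₀).trans_le le_top, lt_top_iff_ne_top.2 hv₀⟩)
  · exact (tconv_le f g u v w).trans_lt (WithTop.add_lt_add_right htop (h u v))

end TropicalConvolution

section Mfun

variable {VG EG VH EH : Type} {G : DirGraph VG EG} {H : DirGraph VH EH} {P : EG → EH → ℤ}

theorem Mfun_eq_top {p : List EH} {v w : VG} (h : ¬ (G.walksFT p.length v w).Nonempty) :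
    Mfun G P p v w = ⊤ := by
  rw [Mfun, Set.not_nonempty_iff_eq_empty.1 h, Set.image_empty, WithTop.sInf_empty]

theorem exists_Mfun_eq [Finite EG] {p : List EH} {v w : VG}
    (h : (G.walksFT p.length v w).Nonempty) :
    ∃ q ∈ G.walksFT p.length v w, Mfun G P p v w = (payoffSum P q p : ℤ) := by
  obtain ⟨q, hq, hmin⟩ := Set.exists_min_image _
    (fun q => ((payoffSum P q p : ℤ) : WithTop ℤ)) (DirGraph.finite_walksFT p.length v w) h
  refine ⟨q, hq, IsLeast.csInf_eq ⟨⟨q, hq, rfl⟩, ?_⟩⟩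
  rintro _ ⟨r, hr, rfl⟩
  exact hmin r hr

theorem Mfun_le [Finite EG] {p : List EH} {v w : VG} {q : List EG}
    (hq : q ∈ G.walksFT p.length v w) : Mfun G P p v w ≤ (payoffSum P q p : ℤ) := by
  obtain ⟨r, hr, hmin⟩ := Set.exists_min_image _
    (fun q => ((payoffSum P q p : ℤ) : WithTop ℤ)) (DirGraph.finite_walksFT p.length v w) ⟨q, hq⟩
  have h : Mfun G P p v w = (payoffSum P r p : ℤ) := by
    refine IsLeast.csInf_eq ⟨⟨r, hr, rfl⟩, ?_⟩
    rintro _ ⟨s, hs, rfl⟩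
    exact hmin s hs
  rw [h]
  exact hmin q hq

theorem le_Mfun [Finite EG] {p : List EH} {v w : VG} {c : WithTop ℤ}
    (h : ∀ q ∈ G.walksFT p.length v w, c ≤ (payoffSum P q p : ℤ)) : c ≤ Mfun G P p v w := by
  by_cases hne : (G.walksFT p.length v w).Nonempty
  · obtain ⟨q, hq, hqe⟩ := exists_Mfun_eq (P := P) hne
    exact (h q hq).trans_eq hqe.symm
  · exact le_top.trans_eq (Mfun_eq_top hne).symm

theorem Mfun_append [Finite VG] [Nonempty VG] [Finite EG] {p p' : List EH} (hp : p ≠ [])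
    (hp' : p' ≠ []) : Mfun G P (p ++ p') = tconv (Mfun G P p) (Mfun G P p') := by
  funext u w
  apply le_antisymm
  · obtain ⟨v, hv⟩ := exists_tconv_eq (Mfun G P p) (Mfun G P p') u w
    rw [hv]
    by_cases h : (G.walksFT p.length u v).Nonempty
    · by_cases h' : (G.walksFT p'.length v w).Nonempty
      · obtain ⟨q, hq, hqe⟩ := exists_Mfun_eq (P := P) h
        obtain ⟨q', hq', hqe'⟩ := exists_Mfun_eq (P := P) h'
        have hqq := DirGraph.append_mem_walksFT hq hq'
        rw [← List.length_append] at hqq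
        rw [hqe, hqe', ← WithTop.coe_add, ← payoffSum_append hq.1]
        exact Mfun_le hqq
      · rw [Mfun_eq_top h', add_top]
        exact le_top
    · rw [Mfun_eq_top h, top_add]
      exact le_top
  · refine le_Mfun fun q hq => ?_
    have hql : q.length = p.length + p'.length := hq.1.trans List.length_append
    have hpos := List.length_pos_of_ne_nil hp
    have hpos' := List.length_pos_of_ne_nil hp'
    have ha : (q.take p.length).length = p.length := by simp; omega
    have hb : (q.drop p.length).length = p'.length := by simp; omega
    have hq' := hq
    rw [← List.take_append_drop p.length q] at hq'
    obtain ⟨v, h₁, h₂⟩ := DirGraph.exists_mem_walksFT_of_append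
      (List.ne_nil_of_length_pos (by omega)) (List.ne_nil_of_length_pos (by omega)) hq'
    rw [ha] at h₁
    rw [hb] at h₂
    refine (tconv_le _ _ u v w).trans ?_
    conv_rhs => rw [← List.take_append_drop p.length q]
    rw [payoffSum_append ha, WithTop.coe_add]
    exact add_le_add (Mfun_le h₁) (Mfun_le h₂)

theorem Mfun_image_walksFT_succ [Finite VG] [Nonempty VG] [Finite EG] {n : ℕ} (hn : n ≠ 0)
    (u w : VH) : Mfun G P '' H.walksFT (n + 1) u w =
      ⋃ v, Set.image2 tconv (Mfun G P '' H.walksFT n u v) (Mfun G P '' H.walksFT 1 v w) := by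
  ext f
  simp only [Set.mem_iUnion, Set.mem_image2]
  constructor
  · rintro ⟨p, hp, rfl⟩
    have hpl : p.length = n + 1 := hp.1
    have ha : (p.take n).length = n := by simp; omega
    have hb : (p.drop n).length = 1 := by simp; omega
    have ha0 : p.take n ≠ [] := List.ne_nil_of_length_pos (by omega)
    have hb0 : p.drop n ≠ [] := List.ne_nil_of_length_pos (by omega)
    rw [← List.take_append_drop n p] at hp
    obtain ⟨v, h₁, h₂⟩ := DirGraph.exists_mem_walksFT_of_append ha0 hb0 hp
    rw [ha] at h₁
    rw [hb] at h₂
    refine ⟨v, _, ⟨_, h₁, rfl⟩, _, ⟨_, h₂, rfl⟩, ?_⟩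
    rw [← Mfun_append ha0 hb0, List.take_append_drop]
  · rintro ⟨v, _, ⟨p, hp, rfl⟩, _, ⟨p', hp', rfl⟩, rfl⟩
    exact ⟨p ++ p', DirGraph.append_mem_walksFT hp hp', Mfun_append hp.2.2.1 hp'.2.2.1⟩

theorem exists_Mfun_ne_top_of_length_eq_one [Finite EG] (hG : G.Irreducible) {p : List EH}
    (hp : p.length = 1) (w : VG) : ∃ v, Mfun G P p v w ≠ ⊤ := by
  obtain ⟨n, q, -, -, hq0, -, hqt⟩ := hG w w
  have he : [q.getLast hq0] ∈ G.walksFT p.length (G.src (q.getLast hq0)) w :=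
    ⟨hp.symm, List.isChain_singleton _, by simp, rfl, hqt⟩
  exact ⟨_, ((Mfun_le he).trans_lt (WithTop.coe_lt_top (payoffSum P _ p))).ne⟩

theorem mem_maxElems_Mfun_or_exists [Nonempty VG] [Finite EH] {n : ℕ} {u v : VH}
    {f : VG → VG → WithTop ℤ} (hf : f ∈ Mfun G P '' H.walksFT n u v) :
    f ∈ maxElems StrictDom (Mfun G P '' H.walksFT n u v) ∨
      ∃ g ∈ maxElems StrictDom (Mfun G P '' H.walksFT n u v), StrictDom f g :=
  mem_maxElems_or_exists_lt not_strictDom_self StrictDom.trans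
    ((DirGraph.finite_walksFT n u v).image _) hf

/-- `M†_{n+1}` is determined by `M†_n`. -/
theorem maxElems_Mfun_succ [Finite VG] [Finite EG] [Finite EH] [Nonempty VG]
    (hG : G.Irreducible) {n : ℕ} (hn : n ≠ 0) (u w : VH) :
    maxElems StrictDom (Mfun G P '' H.walksFT (n + 1) u w) = maxElems StrictDom
      (⋃ v, Set.image2 tconv (maxElems StrictDom (Mfun G P '' H.walksFT n u v))
        (Mfun G P '' H.walksFT 1 v w)) := by
  rw [Mfun_image_walksFT_succ hn]
  apply maxElems_eq_of_cofinal StrictDom.trans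
  · exact Set.iUnion_mono fun v => Set.image2_subset_right fun f hf => hf.1
  · simp only [Set.mem_iUnion, Set.mem_image2]
    rintro _ ⟨v, f, hf, g, hg, rfl⟩
    rcases mem_maxElems_Mfun_or_exists hf with h | ⟨f', hf', hff'⟩
    · exact Or.inl ⟨v, f, h, g, hg, rfl⟩
    · refine Or.inr ⟨_, ⟨v, f', hf', g, hg, rfl⟩, hff'.tconv_right ?_⟩
      obtain ⟨p, hp, rfl⟩ := hg
      exact exists_Mfun_ne_top_of_length_eq_one hG hp.1

theorem maxElems_Mfun_succ_eq_addConst_image [Finite VG] [Finite EG] [Finite EH] [Nonempty VG]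
    (hG : G.Irreducible) {m n : ℕ} (hm : m ≠ 0) (hn : n ≠ 0) {c : ℤ}
    (h : ∀ u v : VH, maxElems StrictDom (Mfun G P '' H.walksFT m u v) =
      addConst c '' maxElems StrictDom (Mfun G P '' H.walksFT n u v)) (u w : VH) :
    maxElems StrictDom (Mfun G P '' H.walksFT (m + 1) u w) =
      addConst c '' maxElems StrictDom (Mfun G P '' H.walksFT (n + 1) u w) := by
  rw [maxElems_Mfun_succ hG hm, maxElems_Mfun_succ hG hn, ← maxElems_addConst_image,
    Set.image_iUnion]
  congr 1
  refine Set.iUnion_congr fun v => ?_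
  rw [h, Set.image2_image_left, Set.image_image2]
  simp only [tconv_addConst]

end Mfun

section Value

variable {VG EG VH EH : Type} [Finite EG] [Finite EH]
  {G : DirGraph VG EG} {H : DirGraph VH EH} {P : EG → EH → ℤ}

theorem Vn_le_and_le {n : ℕ} (hGn : (G.walks n).Nonempty) (hHn : (H.walks n).Nonempty) :
    (∃ p ∈ H.walks n, ∀ q ∈ G.walks n, Vn G H P n ≤ payoffSum P q p) ∧
      ∀ p ∈ H.walks n, ∃ q ∈ G.walks n, payoffSum P q p ≤ Vn G H P n := by
  set m : List EH → ℤ := fun p => sInf ((fun q => payoffSum P q p) '' G.walks n) with hm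
  have hfin (p : List EH) : ((fun q => payoffSum P q p) '' G.walks n).Finite :=
    (DirGraph.finite_walks n).image _
  have hfin' : (m '' H.walks n).Finite := (DirGraph.finite_walks n).image _
  constructor
  · obtain ⟨p, hp, hpe⟩ : sSup (m '' H.walks n) ∈ m '' H.walks n :=
      Int.csSup_mem (hHn.image _) hfin'.bddAbove
    refine ⟨p, hp, fun q hq => ?_⟩
    rw [Vn, ← hm, ← hpe]
    exact csInf_le (hfin p).bddBelow ⟨q, hq, rfl⟩
  · intro p hp
    obtain ⟨q, hq, hqe⟩ := Int.csInf_mem (hGn.image fun q => payoffSum P q p) (hfin p).bddBelow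
    exact ⟨q, hq, hqe.trans_le (le_csSup hfin'.bddAbove ⟨p, hp, rfl⟩)⟩

theorem exists_mem_maxElems_Vn_le [Nonempty VG] {n : ℕ} (hn : n ≠ 0)
    (hGn : (G.walks n).Nonempty) (hHn : (H.walks n).Nonempty) :
    ∃ u v : VH, ∃ f ∈ maxElems StrictDom (Mfun G P '' H.walksFT n u v),
      ∀ x y, (Vn G H P n : WithTop ℤ) ≤ f x y := by
  obtain ⟨⟨p, hp, hpV⟩, -⟩ := Vn_le_and_le (P := P) hGn hHn
  obtain ⟨u, v, hpuv⟩ := DirGraph.exists_mem_walksFT_of_mem_walks hn hp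
  have hM (x y : VG) : (Vn G H P n : WithTop ℤ) ≤ Mfun G P p x y := by
    refine le_Mfun fun q hq => WithTop.coe_le_coe.2 (hpV q ?_)
    rw [hp.1] at hq
    exact DirGraph.walksFT_subset_walks hq
  rcases mem_maxElems_Mfun_or_exists (G := G) (P := P) ⟨p, hpuv, rfl⟩ with h | ⟨f, hf, hpf⟩
  · exact ⟨u, v, _, h, hM⟩
  · exact ⟨u, v, f, hf, fun x y => (hM x y).trans (hpf x y).le⟩

theorem exists_le_Vn_of_mem_Mfun_image {n : ℕ} (hn : n ≠ 0) (hGn : (G.walks n).Nonempty)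
    {u v : VH} {f : VG → VG → WithTop ℤ} (hf : f ∈ Mfun G P '' H.walksFT n u v) :
    ∃ x y, f x y ≤ Vn G H P n := by
  obtain ⟨p, hp, rfl⟩ := hf
  have hp' := DirGraph.walksFT_subset_walks hp
  obtain ⟨q, hq, hqV⟩ := (Vn_le_and_le (P := P) hGn ⟨p, hp'⟩).2 p hp'
  obtain ⟨x, y, hxy⟩ := DirGraph.exists_mem_walksFT_of_mem_walks hn hq
  rw [← hp.1] at hxy
  exact ⟨x, y, (Mfun_le hxy).trans (WithTop.coe_le_coe.2 hqV)⟩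

theorem Vn_eq_add_of_maxElems_eq [Nonempty VG] {m n : ℕ} (hm : m ≠ 0) (hn : n ≠ 0)
    (hGm : (G.walks m).Nonempty) (hHm : (H.walks m).Nonempty) (hGn : (G.walks n).Nonempty)
    (hHn : (H.walks n).Nonempty) {c : ℤ}
    (h : ∀ u v : VH, maxElems StrictDom (Mfun G P '' H.walksFT m u v) =
      addConst c '' maxElems StrictDom (Mfun G P '' H.walksFT n u v)) :
    Vn G H P m = Vn G H P n + c := by
  apply le_antisymm
  · obtain ⟨u, v, f, hf, hVf⟩ := exists_mem_maxElems_Vn_le (P := P) hm hGm hHm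
    rw [h] at hf
    obtain ⟨g, hg, rfl⟩ := hf
    obtain ⟨x, y, hxy⟩ := exists_le_Vn_of_mem_Mfun_image hn hGn hg.1
    have := (hVf x y).trans (add_le_add_left hxy (c : WithTop ℤ))
    exact_mod_cast this
  · obtain ⟨u, v, g, hg, hVg⟩ := exists_mem_maxElems_Vn_le (P := P) hn hGn hHn
    have hf := Set.mem_image_of_mem (addConst c) hg
    rw [← h] at hf
    obtain ⟨x, y, hxy⟩ := exists_le_Vn_of_mem_Mfun_image hm hGm hf.1
    have := (add_le_add_left (hVg x y) (c : WithTop ℤ)).trans hxy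
    exact_mod_cast this

/-- For long walks, all entries of the matrices in `M†_n` are within a constant of `V_n`. -/
theorem exists_bound_maxElems [Finite VG] [Finite VH] (hG : G.Primitive) (hH : H.Primitive)
    (P : EG → EH → ℤ) :
    ∃ (N : ℕ) (C : ℤ), ∀ n ≥ N, ∀ u v : VH,
      ∀ f ∈ maxElems StrictDom (Mfun G P '' H.walksFT n u v), ∀ x y,
        ∃ z : ℤ, f x y = z ∧ |z - Vn G H P n| ≤ C := by
  obtain ⟨N₁, C₁, h₁⟩ := hG.exists_reroute P
  obtain ⟨N₂, C₂, h₂⟩ := hH.exists_reroute (flip P)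
  obtain ⟨N₃, h₃⟩ := hG.exists_walksFT_nonempty
  refine ⟨max N₁ (max N₂ N₃), C₁ + max C₂ 0, fun n hn u v f hf x y => ?_⟩
  obtain ⟨⟨p, hp, rfl⟩, hmax⟩ := hf
  have hpl : p.length = n := hp.1
  have hpw := DirGraph.walksFT_subset_walks hp
  have hne : (G.walksFT n x y).Nonempty := h₃ n (by omega) x y
  obtain ⟨⟨p₀, hp₀, hp₀V⟩, hV⟩ := Vn_le_and_le (P := P)
    (hne.mono DirGraph.walksFT_subset_walks) ⟨p, hpw⟩
  rw [← hpl] at hne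
  obtain ⟨r, hr, hre⟩ := exists_Mfun_eq (P := P) hne
  have hrw := DirGraph.walksFT_subset_walks hr
  rw [hpl] at hrw
  refine ⟨_, hre, abs_le.2 ⟨?_, ?_⟩⟩
  · by_contra! hlt
    obtain ⟨p₁, hp₁, hpp₁⟩ := h₂ n (by omega) p₀ hp₀ u v
    refine hmax ⟨_, ⟨p₁, hp₁, rfl⟩, fun x' y' => ?_⟩
    obtain ⟨s, hs, hrs⟩ := h₁ n (by omega) r hrw x' y'
    have hsp : Mfun G P p x' y' ≤ (payoffSum P s p : ℤ) := Mfun_le (by rwa [hpl])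
    have hlow : ((Vn G H P n - C₂ : ℤ) : WithTop ℤ) ≤ Mfun G P p₁ x' y' := by
      refine le_Mfun fun t ht => WithTop.coe_le_coe.2 ?_
      rw [hp₁.1] at ht
      have h := (abs_le.1 (hpp₁ t ht.1)).2
      rw [payoffSum_flip, payoffSum_flip] at h
      linarith [hp₀V t (DirGraph.walksFT_subset_walks ht)]
    refine hsp.trans_lt (lt_of_lt_of_le (WithTop.coe_lt_coe.2 ?_) hlow)
    linarith [(abs_le.1 (hrs p hpl)).1, le_max_left C₂ 0]
  · obtain ⟨q, hq, hqV⟩ := hV p hpw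
    obtain ⟨s, hs, hqs⟩ := h₁ n (by omega) q hq x y
    have hsp : Mfun G P p x y ≤ (payoffSum P s p : ℤ) := Mfun_le (by rwa [hpl])
    rw [hre, WithTop.coe_le_coe] at hsp
    linarith [(abs_le.1 (hqs p hpl)).1, le_max_right C₂ 0]

/-- The normalized families `M†_n` take finitely many values, so two of them agree up to a
constant. -/
theorem exists_lt_maxElems_eq_addConst_image [Finite VG] [Finite VH] (hG : G.Primitive)
    (hH : H.Primitive) (P : EG → EH → ℤ) (N : ℕ) :
    ∃ m ≥ N, ∃ k > 0, ∃ c : ℤ, ∀ u v : VH,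
      maxElems StrictDom (Mfun G P '' H.walksFT (m + k) u v) =
        addConst c '' maxElems StrictDom (Mfun G P '' H.walksFT m u v) := by
  obtain ⟨M, C, hC⟩ := exists_bound_maxElems hG hH P
  set T : ℕ → VH → VH → Set (VG → VG → WithTop ℤ) :=
    fun n u v => maxElems StrictDom (Mfun G P '' H.walksFT n u v)
  set box : Set (VG → VG → WithTop ℤ) :=
    {f | ∀ x, f x ∈ {g : VG → WithTop ℤ | ∀ y, g y ∈ (fun z : ℤ => (z : WithTop ℤ)) ''
      Set.Icc (-C) C}}
  have hbox : box.Finite :=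
    Set.Finite.pi' fun _ => Set.Finite.pi' fun _ => (Set.finite_Icc (-C) C).image _
  set families : Set (VH → VH → Set (VG → VG → WithTop ℤ)) :=
    {S | ∀ u, S u ∈ {R : VH → Set (VG → VG → WithTop ℤ) | ∀ v, R v ∈ 𝒫 box}}
  have hfamilies : families.Finite :=
    Set.Finite.pi' fun _ => Set.Finite.pi' fun _ => hbox.finite_subsets
  obtain ⟨i, j, hij, h⟩ := Set.Finite.exists_lt_map_eq_of_forall_mem (t := families)
    (f := fun n u v => addConst (-Vn G H P (max M N + n)) '' T (max M N + n) u v) (by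
      rintro n u v _ ⟨f, hf, rfl⟩ x y
      obtain ⟨z, hz, hzC⟩ := hC (max M N + n) (by omega) u v f hf x y
      refine ⟨z - Vn G H P (max M N + n), abs_le.1 hzC, ?_⟩
      rw [addConst, hz, sub_eq_add_neg]
      rfl) hfamilies
  refine ⟨max M N + i, by omega, j - i, by omega,
    Vn G H P (max M N + j) - Vn G H P (max M N + i), fun u v => ?_⟩
  have huv : addConst (-Vn G H P (max M N + i)) '' T (max M N + i) u v =
      addConst (-Vn G H P (max M N + j)) '' T (max M N + j) u v := congrFun (congrFun h u) v
  rw [show max M N + i + (j - i) = max M N + j by omega]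
  have := congrArg (fun S => addConst (Vn G H P (max M N + j)) '' S) huv
  simp only [Set.image_image, addConst_addConst, neg_add_cancel, addConst_zero,
    Set.image_id'] at this
  rw [sub_eq_neg_add]
  exact this.symm

end Value

theorem tendsto_div_of_eventually_add_eq {a : ℕ → ℤ} {N k : ℕ} {c : ℤ} (hk : 0 < k)
    (h : ∀ n ≥ N, a (n + k) = a n + c) :
    Filter.Tendsto (fun n : ℕ => (a n : ℝ) / n) Filter.atTop (nhds ((c : ℝ) / (k : ℝ))) := by
  set d : ℕ → ℝ := fun n => a n * k - n * c with hd
  have hper (n : ℕ) (hn : n ≥ N) : d (n + k) = d n := by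
    simp only [hd, h n hn]
    push_cast
    ring
  have hbound (n : ℕ) : |d n| ≤ ∑ i ∈ Finset.range (N + k), |d i| := by
    induction n using Nat.strong_induction_on with
    | _ n ih =>
      by_cases hn : n < N + k
      · exact Finset.single_le_sum (f := fun i => |d i|) (fun _ _ => abs_nonneg _)
          (Finset.mem_range.2 hn)
      · have := hper (n - k) (by omega)
        rw [Nat.sub_add_cancel (by omega)] at this
        rw [this]
        exact ih _ (by omega)
  have hk' : (k : ℝ) ≠ 0 := by positivity
  have hlim : Filter.Tendsto (fun n : ℕ => d n / k / n) Filter.atTop (nhds 0) := by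
    refine squeeze_zero_norm (fun n => ?_) (tendsto_const_div_atTop_nhds_zero_nat
      ((∑ i ∈ Finset.range (N + k), |d i|) / k))
    rw [Real.norm_eq_abs, abs_div, abs_div, Nat.abs_cast, Nat.abs_cast]
    gcongr
    exact hbound n
  rw [← zero_add ((c : ℝ) / k)]
  refine (hlim.add_const _).congr' ?_
  filter_upwards [Filter.eventually_gt_atTop 0] with n hn
  have hn' : (n : ℝ) ≠ 0 := by positivity
  simp only [hd]
  field_simp
  ring

/-- Eventual periodicity of `M†_n` and of `V_n`, and the consequence
`lim V_n / n = V†/k`. -/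
theorem Mdagger_eventually_periodic {VG EG VH EH : Type} [Fintype VG] [Fintype EG]
    [Fintype VH] [Fintype EH] (G : DirGraph VG EG) (H : DirGraph VH EH)
    (hG : G.Primitive) (hH : H.Primitive) (P : EG → EH → ℤ) :
    (∃ (n₁ k : ℕ) (Vd : ℤ), 0 < k ∧ ∀ v w : VH, ∀ n ≥ n₁,
        (maxElems StrictDom (Mfun G P '' H.walksFT (n + k) v w)
            = addConst Vd '' maxElems StrictDom (Mfun G P '' H.walksFT n v w))
        ∧ Vn G H P (n + k) = Vn G H P n + Vd)
    ∧ ∀ (n₁ k : ℕ) (Vd : ℤ), 0 < k →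
        (∀ v w : VH, ∀ n ≥ n₁,
          maxElems StrictDom (Mfun G P '' H.walksFT (n + k) v w)
            = addConst Vd '' maxElems StrictDom (Mfun G P '' H.walksFT n v w)) →
        Filter.Tendsto (fun n : ℕ => (Vn G H P n : ℝ) / n) Filter.atTop
          (nhds ((Vd : ℝ) / (k : ℝ))) := by
  have := hG.nonempty
  obtain ⟨v₀⟩ := hG.nonempty
  obtain ⟨w₀⟩ := hH.nonempty
  obtain ⟨NG, hNG⟩ := hG.exists_walksFT_nonempty
  obtain ⟨NH, hNH⟩ := hH.exists_walksFT_nonempty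
  set N := max 1 (max NG NH)
  have hGn (n : ℕ) (hn : n ≥ N) : (G.walks n).Nonempty :=
    (hNG n (by omega) v₀ v₀).mono DirGraph.walksFT_subset_walks
  have hHn (n : ℕ) (hn : n ≥ N) : (H.walks n).Nonempty :=
    (hNH n (by omega) w₀ w₀).mono DirGraph.walksFT_subset_walks
  have hV (n k : ℕ) (hn : n ≥ N) (c : ℤ) (h : ∀ u v : VH,
      maxElems StrictDom (Mfun G P '' H.walksFT (n + k) u v) =
        addConst c '' maxElems StrictDom (Mfun G P '' H.walksFT n u v)) :
      Vn G H P (n + k) = Vn G H P n + c :=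
    Vn_eq_add_of_maxElems_eq (by omega) (by omega) (hGn _ (by omega)) (hHn _ (by omega))
      (hGn n hn) (hHn n hn) h
  constructor
  · obtain ⟨m, hm, k, hk, c, h⟩ := exists_lt_maxElems_eq_addConst_image hG hH P N
    have hper (n : ℕ) (hn : n ≥ m) : ∀ u v : VH,
        maxElems StrictDom (Mfun G P '' H.walksFT (n + k) u v) =
          addConst c '' maxElems StrictDom (Mfun G P '' H.walksFT n u v) := by
      induction n, hn using Nat.le_induction with
      | base => exact h
      | succ n hn ih =>
        intro u v
        rw [add_right_comm]
        exact maxElems_Mfun_succ_eq_addConst_image hG.1 (by omega) (by omega) ih u v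
    exact ⟨m, k, c, hk, fun v w n hn => ⟨hper n hn v w, hV n k (by omega) c (hper n hn)⟩⟩
  · intro n₁ k c hk h
    exact tendsto_div_of_eventually_add_eq (N := max n₁ N) hk fun n hn =>
      hV n k (by omega) c fun u v => h u v n (by omega)
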